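/- Let p(z_1, ..., z_m) be a real stable polynomial and x ∈ ℝ^m such that p has no zeros in {y ∈ ℝ^m : y ≥ x}. Suppose that Φ_p^j(x) + 1/δ ≤ 1 for some index j ∈ {1, ..., m} and some δ > 0. Then: (i) the polynomial (1 - ∂_j)p has no zeros in {y ∈ ℝ^m : y ≥ x}; and (ii) for every i = 1, ..., m, Φ^i_{(1-∂_j)p}(x + δ e_j) ≤ Φ^i_p(x), where e_j is the j-th canonical basis vector of ℝ^m. -/

import Mathlib

open MvPolynomial

/-- A polynomial in `m` complex variables is *real stable* if all its coefficients are
real and it has no zeros in `ℍ^m`, where `ℍ` is the open upper half-plane. -/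
def RealStable {m : ℕ} (p : MvPolynomial (Fin m) ℂ) : Prop :=
  (∀ c : Fin m →₀ ℕ, ∃ r : ℝ, MvPolynomial.coeff c p = (r : ℂ)) ∧
  ∀ w : Fin m → ℂ, (∀ i, 0 < (w i).im) → MvPolynomial.eval w p ≠ 0

/-- The barrier function `Φ_p^i(y) = (∂_i p)(y) / p(y)` of `p` in direction `i`,
evaluated at a real point `y` (for `p` with real coefficients the value is real, and we
take the real part). -/
noncomputable def barrier {m : ℕ} (p : MvPolynomial (Fin m) ℂ) (i : Fin m)
    (y : Fin m → ℝ) : ℝ :=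
  ((MvPolynomial.eval (fun l => ((y l : ℂ))) (MvPolynomial.pderiv i p)) /
    (MvPolynomial.eval (fun l => ((y l : ℂ))) p)).re

namespace Polynomial

theorem aeval_ofReal_eq (P : ℝ[X]) (t : ℝ) : aeval (t : ℂ) P = ((P.eval t : ℝ) : ℂ) := by
  simpa using Polynomial.aeval_algebraMap_apply ℂ t P

open Filter Topology in
theorem sin_mul_nonneg_of_im_div_nonpos {A B : ℝ[X]} {r : ℝ} {n : ℕ} (hB : B.eval r ≠ 0)
    (h : ∀ z : ℂ, 0 < z.im → (aeval z A / aeval z ((X - C r) ^ n * B)).im ≤ 0)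
    {θ : ℝ} (h0 : 0 < θ) (hπ : θ < Real.pi) :
    0 ≤ A.eval r / B.eval r * Real.sin (n * θ) := by
  have hcont : ContinuousAt (fun ε : ℝ => (aeval ((r : ℂ) + ε * Complex.exp (θ * Complex.I)) A /
      aeval ((r : ℂ) + ε * Complex.exp (θ * Complex.I)) B *
      Complex.exp ((-(n * θ) : ℝ) * Complex.I)).im) 0 := by
    refine Complex.continuous_im.continuousAt.comp (ContinuousAt.mul (ContinuousAt.div ?_ ?_ ?_)
      continuousAt_const)
    · exact (A.continuous_aeval.comp (by fun_prop)).continuousAt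
    · exact (B.continuous_aeval.comp (by fun_prop)).continuousAt
    · simpa [aeval_ofReal_eq] using hB
  have hle : ∀ᶠ ε : ℝ in 𝓝[>] 0, (aeval ((r : ℂ) + ε * Complex.exp (θ * Complex.I)) A /
      aeval ((r : ℂ) + ε * Complex.exp (θ * Complex.I)) B *
      Complex.exp ((-(n * θ) : ℝ) * Complex.I)).im ≤ 0 := by
    filter_upwards [self_mem_nhdsWithin] with ε (hε : 0 < ε)
    have hsin : 0 < Real.sin θ := Real.sin_pos_of_pos_of_lt_pi h0 hπ
    have him : 0 < ((r : ℂ) + ε * Complex.exp (θ * Complex.I)).im := by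
      simpa [Complex.exp_ofReal_mul_I_im] using mul_pos hε hsin
    have key := h _ him
    have hrw : aeval ((r : ℂ) + ε * Complex.exp (θ * Complex.I)) A /
        aeval ((r : ℂ) + ε * Complex.exp (θ * Complex.I)) ((X - C r) ^ n * B) =
        (((ε ^ n)⁻¹ : ℝ) : ℂ) * (aeval ((r : ℂ) + ε * Complex.exp (θ * Complex.I)) A /
        aeval ((r : ℂ) + ε * Complex.exp (θ * Complex.I)) B *
        Complex.exp ((-(n * θ) : ℝ) * Complex.I)) := by
      have he : Complex.exp ((-(n * θ) : ℝ) * Complex.I) =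
          (Complex.exp (θ * Complex.I) ^ n)⁻¹ := by
        rw [← Complex.exp_nat_mul, ← Complex.exp_neg]
        congr 1
        push_cast
        ring
      rw [he]
      simp only [map_mul, map_pow, map_sub, aeval_X, aeval_C, Complex.coe_algebraMap,
        add_sub_cancel_left, Complex.ofReal_inv, Complex.ofReal_pow, mul_pow, div_eq_mul_inv,
        mul_inv]
      ring
    rw [hrw, Complex.im_ofReal_mul] at key
    exact nonpos_of_mul_nonpos_right key (by positivity)
  have hlim := le_of_tendsto (hcont.tendsto.mono_left nhdsWithin_le_nhds) hle
  simp only [Complex.ofReal_zero, zero_mul, add_zero, aeval_ofReal_eq, ← Complex.ofReal_div,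
    Complex.im_ofReal_mul, Complex.exp_ofReal_mul_I_im, Real.sin_neg] at hlim
  linarith

/-- A rational function mapping the upper half-plane to the closed lower half-plane has only
simple poles on the real line, and these have nonnegative residues. -/
theorem simple_pole_of_im_div_nonpos {A B : ℝ[X]} {r : ℝ} {n : ℕ} (hn : 1 ≤ n)
    (hA : A.eval r ≠ 0) (hB : B.eval r ≠ 0)
    (h : ∀ z : ℂ, 0 < z.im → (aeval z A / aeval z ((X - C r) ^ n * B)).im ≤ 0) :
    n = 1 ∧ 0 ≤ A.eval r / B.eval r := by
  have hn0 : (0 : ℝ) < n := by exact_mod_cast hn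
  have hπ := Real.pi_pos
  have h1 : 0 ≤ A.eval r / B.eval r := by
    have := sin_mul_nonneg_of_im_div_nonpos hB h (θ := Real.pi / 2 / n) (by positivity) (by
      rw [div_lt_iff₀ hn0]
      have : (1 : ℝ) ≤ n := by exact_mod_cast hn
      nlinarith)
    rwa [mul_div_cancel₀ _ hn0.ne', Real.sin_pi_div_two, mul_one] at this
  refine ⟨?_, h1⟩
  by_contra hne
  have h2 : (2 : ℝ) ≤ n := by exact_mod_cast (show 2 ≤ n by omega)
  have := sin_mul_nonneg_of_im_div_nonpos hB h (θ := (Real.pi / 2 + Real.pi) / n)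
    (by positivity) (by
      rw [div_lt_iff₀ hn0]
      nlinarith)
  rw [mul_div_cancel₀ _ hn0.ne', Real.sin_add_pi, Real.sin_pi_div_two] at this
  have h3 : A.eval r / B.eval r = 0 := by linarith
  exact div_ne_zero hA hB h3

/-- A real polynomial without zeros in the upper half-plane splits over `ℝ`. -/
theorem splits_of_aeval_ne_zero {B : ℝ[X]} (hB : ∀ z : ℂ, 0 < z.im → aeval z B ≠ 0) :
    B.Splits := by
  refine Splits.of_splits_map (algebraMap ℝ ℂ) (IsAlgClosed.splits _) fun a ha => ?_
  have ha0 : aeval a B = 0 := by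
    have := (mem_roots'.1 ha).2
    rwa [IsRoot.def, eval_map_algebraMap] at this
  refine ⟨a.re, Complex.ext (by simp) ?_⟩
  rcases lt_trichotomy a.im 0 with hlt | heq | hgt
  · refine absurd ?_ (hB ((starRingEnd ℂ) a) (by simpa using hlt))
    rw [aeval_conj, ha0, map_zero]
  · simp [heq]
  · exact absurd ha0 (hB a hgt)

theorem derivative_eval_nonpos_of_im_div_nonpos {A B : ℝ[X]}
    (him : ∀ z : ℂ, 0 < z.im → (aeval z A / aeval z B).im ≤ 0) {t : ℝ} (ht : B.eval t ≠ 0) :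
    (A.derivative.eval t * B.eval t - A.eval t * B.derivative.eval t) / B.eval t ^ 2 ≤ 0 := by
  set D := (A.derivative.eval t * B.eval t - A.eval t * B.derivative.eval t) / B.eval t ^ 2
  have hBt : aeval (t : ℂ) B ≠ 0 := by simpa [aeval_ofReal_eq] using ht
  have h1 : HasDerivAt (fun z : ℂ => aeval z A / aeval z B) (D : ℂ)
      ((t : ℂ) + (0 : ℝ) * Complex.I) := by
    have := (A.hasDerivAt_aeval (t : ℂ)).fun_div (B.hasDerivAt_aeval (t : ℂ)) hBt
    simpa [aeval_ofReal_eq, D] using this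
  have h2 : HasDerivAt (fun ε : ℝ => (t : ℂ) + ε * Complex.I) Complex.I (0 : ℝ) := by
    simpa using
      ((Complex.ofRealCLM.hasDerivAt (x := (0 : ℝ))).mul_const Complex.I).const_add (t : ℂ)
  have h3 : HasDerivAt (fun ε : ℝ => (aeval ((t : ℂ) + ε * Complex.I) A /
      aeval ((t : ℂ) + ε * Complex.I) B).im) D 0 := by
    have h4 := h1.comp (0 : ℝ) h2
    have h5 := Complex.imCLM.hasFDerivAt.comp_hasDerivAt (0 : ℝ) h4
    simpa [Function.comp_def] using h5
  have h6 := h3.hasDerivWithinAt (s := Set.Ioi 0)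
  rw [hasDerivWithinAt_iff_tendsto_slope' (by simp)] at h6
  refine le_of_tendsto h6 ?_
  filter_upwards [self_mem_nhdsWithin] with ε (hε : 0 < ε)
  rw [slope_def_field]
  have h7 := him ((t : ℂ) + ε * Complex.I) (by simpa using hε)
  have h8 : (aeval ((t : ℂ) + (0 : ℝ) * Complex.I) A /
      aeval ((t : ℂ) + (0 : ℝ) * Complex.I) B).im = 0 := by
    simp [aeval_ofReal_eq, ← Complex.ofReal_div]
  rw [h8]
  exact div_nonpos_of_nonpos_of_nonneg (by linarith) (by linarith)

open Finset in
/-- A real rational function that is bounded at infinity, has no poles in the upper half-plane and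
maps it to the closed lower half-plane is a constant plus a nonnegative combination of functions
`1 / (t - r)` with real poles `r`. -/
theorem exists_partial_fractions {A B : ℝ[X]} (hB : ∀ z : ℂ, 0 < z.im → aeval z B ≠ 0)
    (him : ∀ z : ℂ, 0 < z.im → (aeval z A / aeval z B).im ≤ 0) (hdeg : A.degree ≤ B.degree) :
    ∃ (β : ℝ) (S : Finset ℝ) (c : ℝ → ℝ), (∀ r ∈ S, 0 ≤ c r ∧ B.eval r = 0) ∧
      ∀ t, B.eval t ≠ 0 → A.eval t / B.eval t = β + ∑ r ∈ S, c r / (t - r) := by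
  classical
  have hB0 : B ≠ 0 := by
    rintro rfl
    exact hB Complex.I (by simp) (by simp)
  obtain ⟨a, b, hAa, hBb, hunit⟩ := extract_gcd A B
  set G := gcd A B
  have hcop : IsCoprime a b := (gcd_isUnit_iff a b).1 hunit
  have hG0 : G ≠ 0 := by
    intro h
    rw [h, zero_mul] at hBb
    exact hB0 hBb
  have hb0 : b ≠ 0 := by
    intro h
    rw [h, mul_zero] at hBb
    exact hB0 hBb
  have hb : ∀ z : ℂ, 0 < z.im → aeval z b ≠ 0 := by
    intro z hz h
    apply hB z hz
    rw [hBb, map_mul, h, mul_zero]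
  have hab : ∀ z : ℂ, 0 < z.im → (aeval z a / aeval z b).im ≤ 0 := by
    intro z hz
    have h1 := him z hz
    have h2 := hB z hz
    rw [hBb, map_mul] at h2
    rwa [hAa, hBb, map_mul, map_mul, mul_div_mul_left _ _ (left_ne_zero_of_mul h2)] at h1
  have hdab : a.degree ≤ b.degree := by
    rw [hAa, hBb, degree_mul, degree_mul] at hdeg
    exact (WithBot.add_le_add_iff_left (degree_ne_bot.2 hG0)).1 hdeg
  have hspl : b.Splits := splits_of_aeval_ne_zero hb
  have hpole : ∀ r, b.eval r = 0 → b.rootMultiplicity r = 1 ∧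
      ∀ q : ℝ[X], b = (X - C r) * q → 0 ≤ a.eval r / q.eval r := by
    intro r hr
    have har : a.eval r ≠ 0 := by
      intro h
      obtain ⟨u, v, huv⟩ := hcop
      have := congrArg (eval r) huv
      simp [h, hr] at this
    obtain ⟨q, hq, hnd⟩ := exists_eq_pow_rootMultiplicity_mul_and_not_dvd b hb0 r
    have hqr : q.eval r ≠ 0 := fun h => hnd (dvd_iff_isRoot.2 h)
    have hn : 1 ≤ b.rootMultiplicity r := (rootMultiplicity_pos hb0).2 hr
    have hs := simple_pole_of_im_div_nonpos hn har hqr (by rwa [← hq])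
    refine ⟨hs.1, fun q₂ hq₂ => ?_⟩
    rw [hs.1, pow_one, hq₂] at hq
    rw [mul_left_cancel₀ (X_sub_C_ne_zero r) hq]
    exact hs.2
  set S := b.roots.toFinset with hS
  have hnodup : b.roots.Nodup := by
    rw [Multiset.nodup_iff_count_le_one]
    intro r
    rw [count_roots]
    by_cases hr : b.eval r = 0
    · exact (hpole r hr).1.le
    · rw [rootMultiplicity_eq_zero hr]
      exact zero_le_one
  have hlc : b.leadingCoeff ≠ 0 := leadingCoeff_ne_zero.2 hb0
  have hnodal : b = C b.leadingCoeff * Lagrange.nodal S id := by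
    conv_lhs => rw [hspl.eq_prod_roots]
    rw [Lagrange.nodal_eq, Finset.prod_eq_multiset_prod, hS, Multiset.toFinset_val,
      hnodup.dedup]
    rfl
  have hcard : b.natDegree = #S := by
    rw [hspl.natDegree_eq_card_roots, hS, Multiset.toFinset_card_of_nodup hnodup]
  have hmem : ∀ r ∈ S, b.eval r = 0 := by
    intro r hr
    rw [hS, Multiset.mem_toFinset] at hr
    exact (mem_roots'.1 hr).2
  set β := a.coeff b.natDegree / b.leadingCoeff with hβ
  set f := a - C β * b with hf
  have hfdeg : f.degree < #S := by
    rw [← hcard, degree_lt_iff_coeff_zero]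
    intro k hk
    rw [hf, coeff_sub, coeff_C_mul]
    rcases hk.eq_or_lt with rfl | hlt
    · rw [coeff_natDegree, hβ, div_mul_cancel₀ _ hlc, sub_self]
    · rw [coeff_eq_zero_of_natDegree_lt hlt, mul_zero, sub_zero]
      exact coeff_eq_zero_of_natDegree_lt ((natDegree_le_natDegree hdab).trans_lt hlt)
  have hfint := Lagrange.eq_interpolate (s := S) (v := id) (Set.injOn_id _) hfdeg
  refine ⟨β, S, fun r => Lagrange.nodalWeight S id r * a.eval r / b.leadingCoeff,
    fun r hr => ⟨?_, ?_⟩, fun t ht => ?_⟩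
  · have h1 := (hpole r (hmem r hr)).2 (C b.leadingCoeff * Lagrange.nodal (S.erase r) id) (by
      conv_lhs => rw [hnodal, Lagrange.nodal_eq_mul_nodal_erase hr]
      simp only [id]
      ring)
    rw [eval_mul, eval_C] at h1
    beta_reduce
    rw [Lagrange.nodalWeight_eq_eval_nodal_erase_inv]
    convert h1 using 1
    simp only [id, div_eq_mul_inv, mul_inv]
    ring
  · rw [hBb, eval_mul, hmem r hr, mul_zero]
  · rw [hBb, eval_mul] at ht
    have hbt : b.eval t ≠ 0 := right_ne_zero_of_mul ht
    have htS : ∀ r ∈ S, t ≠ id r := by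
      rintro r hr rfl
      exact hbt (hmem _ hr)
    have hft : a.eval t = β * b.eval t + f.eval t := by
      rw [hf, eval_sub, eval_mul, eval_C]
      ring
    have hnt : b.eval t = b.leadingCoeff * (Lagrange.nodal S id).eval t := by
      conv_lhs => rw [hnodal]
      rw [eval_mul, eval_C]
    have hn0 : (Lagrange.nodal S id).eval t ≠ 0 := by
      rw [hnt] at hbt
      exact right_ne_zero_of_mul hbt
    rw [hAa, hBb, eval_mul, eval_mul, mul_div_mul_left _ _ (left_ne_zero_of_mul ht), hft, add_div,
      mul_div_cancel_right₀ _ hbt, hfint, Lagrange.eval_interpolate_not_at_node _ htS, hnt,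
      mul_comm b.leadingCoeff, mul_div_mul_left _ _ hn0, Finset.sum_div]
    congr 1
    refine Finset.sum_congr rfl fun r hr => ?_
    have : f.eval r = a.eval r := by
      rw [hf, eval_sub, eval_mul, hmem r hr, mul_zero, sub_zero]
    simp only [id, this, div_eq_mul_inv]
    ring

open Filter Topology in
theorem secant_le_of_im_div_nonpos {A B : ℝ[X]} (hB : ∀ z : ℂ, 0 < z.im → aeval z B ≠ 0)
    (him : ∀ z : ℂ, 0 < z.im → (aeval z A / aeval z B).im ≤ 0)
    (hne : ∀ t : ℝ, 0 ≤ t → B.eval t ≠ 0) (hnn : ∀ t : ℝ, 0 ≤ t → 0 ≤ A.eval t / B.eval t)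
    {t : ℝ} (ht : 0 ≤ t) :
    A.eval t / B.eval t - A.eval 0 / B.eval 0 ≤
      t * ((A.derivative.eval t * B.eval t - A.eval t * B.derivative.eval t) / B.eval t ^ 2) := by
  have hderiv : ∀ s : ℝ, 0 ≤ s → HasDerivAt (fun u => A.eval u / B.eval u)
      ((A.derivative.eval s * B.eval s - A.eval s * B.derivative.eval s) / B.eval s ^ 2) s :=
    fun s hs => (A.hasDerivAt s).fun_div (B.hasDerivAt s) (hne s hs)
  have hanti : AntitoneOn (fun u => A.eval u / B.eval u) (Set.Ici 0) := by
    refine antitoneOn_of_deriv_nonpos (convex_Ici 0)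
      (fun s hs => (hderiv s hs).continuousAt.continuousWithinAt)
      (fun s hs => (hderiv s (interior_subset hs)).differentiableAt.differentiableWithinAt)
      fun s hs => ?_
    rw [(hderiv s (interior_subset hs)).deriv]
    exact derivative_eval_nonpos_of_im_div_nonpos him (hne s (interior_subset hs))
  have hdeg : A.degree ≤ B.degree := by
    by_contra hlt
    have hB0 : B ≠ 0 := by
      rintro rfl
      exact hne 0 le_rfl (by simp)
    have htend := abs_div_tendsto_atTop_atTop_of_degree_gt A B (not_le.1 hlt) hB0
    obtain ⟨s, hs, hs0⟩ := ((htend.eventually_gt_atTop (A.eval 0 / B.eval 0)).and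
      (eventually_ge_atTop 0)).exists
    rw [abs_of_nonneg (hnn s hs0)] at hs
    exact absurd (hanti (Set.mem_Ici.2 le_rfl) hs0 hs0) (not_le.2 hs)
  obtain ⟨β, S, c, hS, hR⟩ := exists_partial_fractions hB him hdeg
  have hneg : ∀ r ∈ S, r < 0 := fun r hr => not_le.1 fun h => hne r h (hS r hr).2
  have hsum : HasDerivAt (fun u => β + ∑ r ∈ S, c r / (u - r))
      (∑ r ∈ S, -c r / (t - r) ^ 2) t := by
    refine (HasDerivAt.fun_sum fun r hr => ?_).const_add β
    have hr0 : t - r ≠ 0 := by linarith [hneg r hr]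
    simpa using (hasDerivAt_const t (c r)).fun_div ((hasDerivAt_id t).sub_const r) hr0
  have heq : (fun u => A.eval u / B.eval u) =ᶠ[𝓝 t] fun u => β + ∑ r ∈ S, c r / (u - r) :=
    (B.continuous.continuousAt.eventually_ne (hne t ht)).mono fun u hu => hR u hu
  rw [(hderiv t ht).unique (hsum.congr_of_eventuallyEq heq), hR t (hne t ht),
    hR 0 (hne 0 le_rfl), add_sub_add_left_eq_sub, ← Finset.sum_sub_distrib, Finset.mul_sum]
  refine Finset.sum_le_sum fun r hr => ?_
  have hr0 := hneg r hr
  have h1 : 0 < t - r := by linarith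
  have h2 : c r / (t - r) - c r / (0 - r) - t * (-c r / (t - r) ^ 2) =
      c r * t ^ 2 / (r * (t - r) ^ 2) := by
    have : r ≠ 0 := hr0.ne
    have : t - r ≠ 0 := h1.ne'
    field_simp
    ring
  have h3 : c r * t ^ 2 / (r * (t - r) ^ 2) ≤ 0 :=
    div_nonpos_of_nonneg_of_nonpos (mul_nonneg (hS r hr).1 (sq_nonneg t))
      (mul_nonpos_of_nonpos_of_nonneg hr0.le (sq_nonneg _))
  linarith

theorem norm_prod_sub_le {z₀ z₁ : ℂ} (hz₀ : 0 < z₀.im) (s : Multiset ℂ) (hs : ∀ r ∈ s, r.im ≤ 0) :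
    ‖(s.map (z₁ - ·)).prod‖ ≤
      (1 + ‖z₁ - z₀‖ / z₀.im) ^ Multiset.card s * ‖(s.map (z₀ - ·)).prod‖ := by
  induction s using Multiset.induction_on with
  | empty => simp
  | cons r s ih =>
    have hr : r.im ≤ 0 := hs r (Multiset.mem_cons_self r s)
    have ih' := ih fun q hq => hs q (Multiset.mem_cons_of_mem hq)
    have h1 : z₀.im ≤ ‖z₀ - r‖ := by
      have := (le_abs_self _).trans (Complex.abs_im_le_norm (z₀ - r))
      rw [Complex.sub_im] at this
      linarith
    have h2 : ‖z₁ - r‖ ≤ (1 + ‖z₁ - z₀‖ / z₀.im) * ‖z₀ - r‖ := by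
      calc ‖z₁ - r‖ = ‖(z₁ - z₀) + (z₀ - r)‖ := by ring_nf
        _ ≤ ‖z₁ - z₀‖ + ‖z₀ - r‖ := norm_add_le _ _
        _ = ‖z₁ - z₀‖ / z₀.im * z₀.im + ‖z₀ - r‖ := by rw [div_mul_cancel₀ _ hz₀.ne']
        _ ≤ ‖z₁ - z₀‖ / z₀.im * ‖z₀ - r‖ + ‖z₀ - r‖ := by gcongr
        _ = _ := by ring
    simp only [Multiset.map_cons, Multiset.prod_cons, norm_mul, Multiset.card_cons, pow_succ]
    calc ‖z₁ - r‖ * ‖(s.map (z₁ - ·)).prod‖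
        ≤ ((1 + ‖z₁ - z₀‖ / z₀.im) * ‖z₀ - r‖) *
          ((1 + ‖z₁ - z₀‖ / z₀.im) ^ Multiset.card s * ‖(s.map (z₀ - ·)).prod‖) := by gcongr
      _ = _ := by ring

/-- A Harnack-type estimate for polynomials without zeros in the upper half-plane. -/
theorem norm_eval_le_of_ne_zero {f : ℂ[X]} (hf : ∀ z : ℂ, 0 < z.im → f.eval z ≠ 0) {N : ℕ}
    (hN : f.natDegree ≤ N) {z₀ : ℂ} (z₁ : ℂ) (hz₀ : 0 < z₀.im) :
    ‖f.eval z₁‖ ≤ (1 + ‖z₁ - z₀‖ / z₀.im) ^ N * ‖f.eval z₀‖ := by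
  have hspl : f.Splits := IsAlgClosed.splits f
  have hroots : ∀ r ∈ f.roots, r.im ≤ 0 := fun r hr =>
    not_lt.1 fun h => hf r h (mem_roots'.1 hr).2
  have hcard : Multiset.card f.roots ≤ N := (card_roots' f).trans hN
  have h1 : 1 ≤ 1 + ‖z₁ - z₀‖ / z₀.im := by
    have : 0 ≤ ‖z₁ - z₀‖ / z₀.im := by positivity
    linarith
  rw [hspl.eval_eq_prod_roots z₁, hspl.eval_eq_prod_roots z₀, norm_mul, norm_mul]
  calc ‖f.leadingCoeff‖ * ‖(f.roots.map (z₁ - ·)).prod‖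
      ≤ ‖f.leadingCoeff‖ * ((1 + ‖z₁ - z₀‖ / z₀.im) ^ Multiset.card f.roots *
        ‖(f.roots.map (z₀ - ·)).prod‖) := by
        gcongr
        exact norm_prod_sub_le hz₀ _ hroots
    _ ≤ ‖f.leadingCoeff‖ * ((1 + ‖z₁ - z₀‖ / z₀.im) ^ N * ‖(f.roots.map (z₀ - ·)).prod‖) := by
        gcongr
    _ = _ := by ring

end Polynomial

namespace MvPolynomial

section Line

variable {σ K : Type*} [CommRing K]

/-- The restriction of a multivariate polynomial to the line `t ↦ w + t v`. -/
noncomputable def line (w v : σ → K) (p : MvPolynomial σ K) : Polynomial K :=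
  aeval (fun l => Polynomial.C (w l) + Polynomial.C (v l) * Polynomial.X) p

theorem eval_line (w v : σ → K) (p : MvPolynomial σ K) (z : K) :
    (line w v p).eval z = eval (fun l => w l + v l * z) p := by
  induction p using MvPolynomial.induction_on with
  | C a => simp [line]
  | add p q hp hq => simp_all [line]
  | mul_X p i hp => simp_all [line]

theorem derivative_line_single [DecidableEq σ] (w : σ → K) (i : σ) (p : MvPolynomial σ K) :
    (line w (Pi.single i 1) p).derivative = line w (Pi.single i 1) (pderiv i p) := by
  induction p using MvPolynomial.induction_on with
  | C a => simp [line]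
  | add p q hp hq => simp_all [line]
  | mul_X p k hp =>
    simp only [line, map_mul, aeval_X, Polynomial.derivative_mul, pderiv_mul, map_add] at hp ⊢
    rw [hp]
    by_cases hk : k = i
    · subst hk
      simp
    · simp [pderiv_X_of_ne hk, Pi.single_eq_of_ne hk]

theorem natDegree_line_le (w v : σ → K) (p : MvPolynomial σ K) :
    (line w v p).natDegree ≤ p.totalDegree := by
  have h : ∀ l, (Polynomial.C (w l) + Polynomial.C (v l) * Polynomial.X).natDegree ≤ 1 := fun l =>
    (Polynomial.natDegree_add_le _ _).trans
      (max_le (by simp) ((Polynomial.natDegree_C_mul_le _ _).trans Polynomial.natDegree_X_le))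
  simpa [line] using aeval_natDegree_le p le_rfl _ h

theorem pderiv_comm (i j : σ) (p : MvPolynomial σ K) :
    pderiv i (pderiv j p) = pderiv j (pderiv i p) := by
  classical
  have h : ⁅pderiv (R := K) i, pderiv j⁆ = 0 := derivation_ext fun k => by
    rw [Derivation.commutator_apply, pderiv_X, pderiv_X]
    simp [Pi.single_apply, apply_ite]
  have hcomm := congrArg (fun D => D p) h
  rwa [Derivation.commutator_apply, Derivation.zero_apply, sub_eq_zero] at hcomm

end Line

variable {m : ℕ}

theorem aeval_line (x v : Fin m → ℝ) (p : MvPolynomial (Fin m) ℝ) (z : ℂ) :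
    Polynomial.aeval z (line x v p) =
      eval (fun l => (x l : ℂ) + v l * z) (map (algebraMap ℝ ℂ) p) := by
  induction p using MvPolynomial.induction_on with
  | C a => simp [line]
  | add p q hp hq => simp_all [line]
  | mul_X p i hp => simp_all [line]

theorem eval_map_ofReal (y : Fin m → ℝ) (p : MvPolynomial (Fin m) ℝ) :
    eval (fun l => (y l : ℂ)) (map (algebraMap ℝ ℂ) p) = ((eval y p : ℝ) : ℂ) := by
  induction p using MvPolynomial.induction_on with
  | C a => simp
  | add p q hp hq => simp_all
  | mul_X p i hp => simp_all

section Stable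

variable {P : MvPolynomial (Fin m) ℂ}

open Filter Topology in
theorem tendsto_eval_add_I (Q : MvPolynomial (Fin m) ℂ) (w : Fin m → ℂ) :
    Tendsto (fun ε : ℝ => eval (fun l => w l + ε * Complex.I) Q) (𝓝[>] 0) (𝓝 (eval w Q)) := by
  have h : Continuous fun ε : ℝ => eval (fun l => w l + ε * Complex.I) Q :=
    (continuous_eval Q).comp (by fun_prop)
  simpa using (h.tendsto 0).mono_left nhdsWithin_le_nhds

open Filter Topology in
/-- A stable polynomial that does not vanish at a real point `x` does not vanish on the upper
half-planes attached to `x` in nonnegative directions. -/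
theorem eval_line_ne_zero
    (hP : ∀ w : Fin m → ℂ, (∀ i, 0 < (w i).im) → eval w P ≠ 0)
    {x v : Fin m → ℝ} (hv : 0 ≤ v)
    (hx : eval (fun l => (x l : ℂ)) P ≠ 0) {z : ℂ} (hz : 0 < z.im) :
    eval (fun l => (x l : ℂ) + v l * z) P ≠ 0 := by
  intro h0
  have hle : ∀ᶠ ε : ℝ in 𝓝[>] 0, ‖eval (fun l => (x l : ℂ) + ε * Complex.I) P‖ ≤
      (1 + ‖0 - z‖ / z.im) ^ P.totalDegree *
        ‖eval (fun l => ((x l : ℂ) + v l * z) + ε * Complex.I) P‖ := by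
    filter_upwards [self_mem_nhdsWithin] with ε (hε : 0 < ε)
    have := Polynomial.norm_eval_le_of_ne_zero
      (f := line (fun l => (x l : ℂ) + ε * Complex.I) (fun l => (v l : ℂ)) P)
      (fun u hu => by
        rw [eval_line]
        refine hP _ fun i => ?_
        have : 0 ≤ v i * u.im := mul_nonneg (hv i) hu.le
        simp
        linarith) (natDegree_line_le _ _ _) 0 hz
    simpa [eval_line, add_right_comm] using this
  have hlim := le_of_tendsto_of_tendsto (tendsto_eval_add_I P _).norm
    ((tendsto_eval_add_I P _).norm.const_mul _) hle
  rw [h0, norm_zero, mul_zero] at hlim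
  exact hx (norm_le_zero_iff.1 hlim)

theorem im_pderiv_div_nonpos_of_im_pos
    (hP : ∀ w : Fin m → ℂ, (∀ i, 0 < (w i).im) → eval w P ≠ 0)
    (i : Fin m) {w : Fin m → ℂ} (hw : ∀ l, 0 < (w l).im) :
    (eval w (pderiv i P) / eval w P).im ≤ 0 := by
  set f := line w (Pi.single i 1) P with hf
  have hf0 : f.eval 0 = eval w P := by simp [hf, eval_line]
  have hfd : f.derivative.eval 0 = eval w (pderiv i P) := by
    simp [hf, derivative_line_single, eval_line]
  rw [← hf0, ← hfd, (IsAlgClosed.splits f).eval_derivative_div_eval_of_ne_zero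
    (by rw [hf0]; exact hP w hw)]
  refine Multiset.sum_induction (fun u : ℂ => u.im ≤ 0) _
    (fun a b ha hb => by rw [Complex.add_im]; exact add_nonpos ha hb) (by simp) fun u hu => ?_
  obtain ⟨r, hr, rfl⟩ := Multiset.mem_map.1 hu
  have hr0 : r.im ≤ 0 := by
    by_contra hlt
    have hroot : f.eval r = 0 := (Polynomial.mem_roots'.1 hr).2
    rw [hf, eval_line] at hroot
    refine hP _ (fun l => ?_) hroot
    by_cases hl : l = i
    · subst hl
      simpa using add_pos (hw l) (not_le.1 hlt)
    · simpa [Pi.single_eq_of_ne hl] using hw l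
  rw [one_div, zero_sub, Complex.inv_im, Complex.neg_im, neg_neg]
  exact div_nonpos_of_nonpos_of_nonneg hr0 (Complex.normSq_nonneg _)

theorem im_pderiv_div_nonpos
    (hP : ∀ w : Fin m → ℂ, (∀ i, 0 < (w i).im) → eval w P ≠ 0)
    (i : Fin m) {x v : Fin m → ℝ} (hv : 0 ≤ v)
    (hx : eval (fun l => (x l : ℂ)) P ≠ 0) {z : ℂ} (hz : 0 < z.im) :
    (eval (fun l => (x l : ℂ) + v l * z) (pderiv i P) /
      eval (fun l => (x l : ℂ) + v l * z) P).im ≤ 0 := by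
  have hlim := (Complex.continuous_im.tendsto _).comp
    ((tendsto_eval_add_I (pderiv i P) (fun l => (x l : ℂ) + v l * z)).div
      (tendsto_eval_add_I P _) (eval_line_ne_zero hP hv hx hz))
  refine le_of_tendsto hlim ?_
  filter_upwards [self_mem_nhdsWithin] with ε (hε : 0 < ε)
  refine im_pderiv_div_nonpos_of_im_pos hP i fun l => ?_
  have : 0 ≤ v l * z.im := mul_nonneg (hv l) hz.le
  simp
  linarith

end Stable

section RealStable

variable {p : MvPolynomial (Fin m) ℝ} {x : Fin m → ℝ}

theorem aeval_line_ne_zero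
    (hp : ∀ w : Fin m → ℂ, (∀ i, 0 < (w i).im) → eval w (map (algebraMap ℝ ℂ) p) ≠ 0)
    {v : Fin m → ℝ} (hv : 0 ≤ v) (hx : eval x p ≠ 0)
    (z : ℂ) (hz : 0 < z.im) : Polynomial.aeval z (line x v p) ≠ 0 := by
  rw [aeval_line]
  exact eval_line_ne_zero hp hv (by rwa [eval_map_ofReal, Complex.ofReal_ne_zero]) hz

theorem pderiv_div_nonneg
    (hp : ∀ w : Fin m → ℂ, (∀ i, 0 < (w i).im) → eval w (map (algebraMap ℝ ℂ) p) ≠ 0)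
    (hx : ∀ y, x ≤ y → eval y p ≠ 0)
    (i : Fin m) : 0 ≤ eval x (pderiv i p) / eval x p := by
  have hx0 := hx x le_rfl
  have hv : (0 : Fin m → ℝ) ≤ Pi.single i 1 := Pi.single_nonneg.2 zero_le_one
  set f := line x (Pi.single i 1) p with hf
  have hf0 : f.eval 0 = eval x p := by simp [hf, eval_line]
  have hfd : f.derivative.eval 0 = eval x (pderiv i p) := by
    simp [hf, derivative_line_single, eval_line]
  have hspl : f.Splits := Polynomial.splits_of_aeval_ne_zero (aeval_line_ne_zero hp hv hx0)
  rw [← hf0, ← hfd, hspl.eval_derivative_div_eval_of_ne_zero (by rwa [hf0])]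
  refine Multiset.sum_nonneg fun u hu => ?_
  obtain ⟨r, hr, rfl⟩ := Multiset.mem_map.1 hu
  have hroot : f.eval r = 0 := (Polynomial.mem_roots'.1 hr).2
  rw [hf, eval_line] at hroot
  have hr0 : r < 0 := not_le.1 fun h =>
    hx _ (fun l => le_add_of_nonneg_right (mul_nonneg (hv l) h)) hroot
  exact one_div_nonneg.2 (by linarith)

/-- Monotonicity and convexity of the `i`-th barrier function in a nonnegative direction `v`. -/
theorem barrier_line_bounds
    (hp : ∀ w : Fin m → ℂ, (∀ i, 0 < (w i).im) → eval w (map (algebraMap ℝ ℂ) p) ≠ 0)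
    (hx : ∀ y, x ≤ y → eval y p ≠ 0)
    (i : Fin m) {v : Fin m → ℝ} (hv : 0 ≤ v) {t : ℝ} (ht : 0 ≤ t) :
    ((line x v (pderiv i p)).derivative.eval t * (line x v p).eval t -
      (line x v (pderiv i p)).eval t * (line x v p).derivative.eval t) /
        (line x v p).eval t ^ 2 ≤ 0 ∧
    (line x v (pderiv i p)).eval t / (line x v p).eval t - eval x (pderiv i p) / eval x p ≤
      t * (((line x v (pderiv i p)).derivative.eval t * (line x v p).eval t -
        (line x v (pderiv i p)).eval t * (line x v p).derivative.eval t) /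
          (line x v p).eval t ^ 2) := by
  have hx0 := hx x le_rfl
  have hxt : ∀ s : ℝ, 0 ≤ s → x ≤ fun l => x l + v l * s := fun s hs l =>
    le_add_of_nonneg_right (mul_nonneg (hv l) hs)
  have hne : ∀ s : ℝ, 0 ≤ s → (line x v p).eval s ≠ 0 := fun s hs => by
    rw [eval_line]
    exact hx _ (hxt s hs)
  have him : ∀ z : ℂ, 0 < z.im → (Polynomial.aeval z (line x v (pderiv i p)) /
      Polynomial.aeval z (line x v p)).im ≤ 0 := fun z hz => by
    rw [aeval_line, aeval_line, ← pderiv_map]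
    exact im_pderiv_div_nonpos hp i hv (by rwa [eval_map_ofReal, Complex.ofReal_ne_zero]) hz
  refine ⟨Polynomial.derivative_eval_nonpos_of_im_div_nonpos him (hne t ht), ?_⟩
  have h := Polynomial.secant_le_of_im_div_nonpos (aeval_line_ne_zero hp hv hx0) him hne
    (fun s hs => by
      rw [eval_line, eval_line]
      exact pderiv_div_nonneg hp (fun y hy => hx y ((hxt s hs).trans hy)) i) ht
  rwa [eval_line x v (pderiv i p) 0, eval_line x v p 0, show (fun l => x l + v l * 0) = x by
    simp] at h

theorem pderiv_div_le
    (hp : ∀ w : Fin m → ℂ, (∀ i, 0 < (w i).im) → eval w (map (algebraMap ℝ ℂ) p) ≠ 0)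
    (hx : ∀ y, x ≤ y → eval y p ≠ 0)
    (i : Fin m) {y : Fin m → ℝ} (hy : x ≤ y) :
    eval y (pderiv i p) / eval y p ≤ eval x (pderiv i p) / eval x p := by
  obtain ⟨h1, h2⟩ := barrier_line_bounds hp hx i (v := y - x) (sub_nonneg.2 hy) zero_le_one
  have h3 := h2.trans (mul_nonpos_of_nonneg_of_nonpos zero_le_one h1)
  rw [eval_line, eval_line, show (fun l => x l + (y - x) l * 1) = y by ext l; simp] at h3
  exact sub_nonpos.1 h3

end RealStable

end MvPolynomial

theorem RealStable.exists_map_eq {m : ℕ} {p : MvPolynomial (Fin m) ℂ} (hp : RealStable p) :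
    ∃ q : MvPolynomial (Fin m) ℝ, MvPolynomial.map (algebraMap ℝ ℂ) q = p := by
  refine MvPolynomial.mem_range_map_iff_coeffs_subset.2 fun a ha => ?_
  obtain ⟨c, -, rfl⟩ := MvPolynomial.mem_coeffs_iff.1 ha
  obtain ⟨r, hr⟩ := hp.1 c
  exact ⟨r, hr.symm⟩

theorem barrier_map {m : ℕ} (q : MvPolynomial (Fin m) ℝ) (i : Fin m) (y : Fin m → ℝ) :
    barrier (MvPolynomial.map (algebraMap ℝ ℂ) q) i y = eval y (pderiv i q) / eval y q := by
  rw [barrier, pderiv_map, eval_map_ofReal, eval_map_ofReal, ← Complex.ofReal_div,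
    Complex.ofReal_re]

/-- Suppose the real stable polynomial `p` has no zeros in `{y : y ≥ x}` and
`Φ_p^j(x) + 1/δ ≤ 1` for some direction `j` and some `δ > 0`.  Then
(i) `(1 - ∂_j) p` has no zeros in `{y : y ≥ x}`, and
(ii) `Φ^i_{(1-∂_j)p}(x + δ e_j) ≤ Φ^i_p(x)` for every direction `i`. -/
theorem barrier_shift (m : ℕ) (p : MvPolynomial (Fin m) ℂ)
    (hp : RealStable p) (x : Fin m → ℝ)
    (hx : ∀ y : Fin m → ℝ, x ≤ y → MvPolynomial.eval (fun l => ((y l : ℂ))) p ≠ 0)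
    (j : Fin m) (δ : ℝ) (hδ : 0 < δ)
    (hΦ : barrier p j x + 1 / δ ≤ 1) :
    (∀ y : Fin m → ℝ, x ≤ y →
      MvPolynomial.eval (fun l => ((y l : ℂ))) (p - MvPolynomial.pderiv j p) ≠ 0) ∧
    (∀ i : Fin m,
      barrier (p - MvPolynomial.pderiv j p) i (fun l => x l + if l = j then δ else 0)
        ≤ barrier p i x) := by
  obtain ⟨q, rfl⟩ := hp.exists_map_eq
  replace hx : ∀ y, x ≤ y → eval y q ≠ 0 := fun y hy h =>
    hx y hy (by rw [eval_map_ofReal, h, Complex.ofReal_zero])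
  have hst := hp.2
  rw [barrier_map] at hΦ
  have hδ' : 0 < 1 / δ := one_div_pos.2 hδ
  have hle : ∀ y, x ≤ y → eval y (pderiv j q) / eval y q ≤ 1 - 1 / δ := fun y hy => by
    linarith [pderiv_div_le hst hx j hy]
  rw [pderiv_map, ← map_sub]
  refine ⟨fun y hy => ?_, fun i => ?_⟩
  · rw [eval_map_ofReal, Complex.ofReal_ne_zero, eval_sub]
    intro h
    have h1 := hle y hy
    rw [← sub_eq_zero.1 h, div_self (hx y hy)] at h1
    linarith
  · rw [barrier_map, barrier_map]
    set y : Fin m → ℝ := fun l => x l + if l = j then δ else 0 with hy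
    have hxy : x ≤ y := fun l => le_add_of_nonneg_right (by split_ifs <;> linarith)
    have hline : (fun l => x l + (Pi.single j 1 : Fin m → ℝ) l * δ) = y := by
      ext l
      simp [hy, Pi.single_apply]
    obtain ⟨hD, hsec⟩ := barrier_line_bounds hst hx i (v := Pi.single j 1)
      (Pi.single_nonneg.2 zero_le_one) hδ.le
    simp only [derivative_line_single, eval_line, hline] at hD hsec
    have hv := hle y hxy
    have hy0 := hx y hxy
    rw [map_sub, map_sub, map_sub, pderiv_comm i j]
    generalize eval y (pderiv j (pderiv i q)) = w at *
    generalize eval y (pderiv i q) = u at *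
    generalize eval y (pderiv j q) = v at *
    generalize eval y q = c at *
    generalize eval x (pderiv i q) / eval x q = R at *
    set D := (w * c - u * v) / c ^ 2 with hDdef
    have hpos : 1 / δ ≤ 1 - v / c := by linarith
    have hpos' : 0 < 1 - v / c := hδ'.trans_le hpos
    have hcv : c - v ≠ 0 := by
      have : c - v = c * (1 - v / c) := by field_simp
      rw [this]
      exact mul_ne_zero hy0 hpos'.ne'
    have hkey : (u - w) / (c - v) = u / c - D / (1 - v / c) := by
      rw [hDdef, show 1 - v / c = (c - v) / c by field_simp]
      field_simp
      ring
    have hinv : 1 / (1 - v / c) ≤ δ := by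
      rw [div_le_comm₀ hpos' hδ]
      exact hpos
    have hmul : δ * D ≤ D / (1 - v / c) := by
      rw [div_eq_mul_one_div, mul_comm δ]
      exact mul_le_mul_of_nonpos_left hinv hD
    rw [hkey]
    linarith
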